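/- Let d < n be positive integers. Then dim_ℂ J(n,d) = Σ d(μ)², the sum being over all partitions μ of n with more than d parts; equivalently, dim_ℂ (ℂ[S_n]/J(n,d)) = Σ d(μ)², the sum over partitions μ of n with at most d parts. -/

import Mathlib

open Finset

variable {n : ℕ}

/-- The parts of a partition sorted in weakly decreasing order, `μ_1 ≥ μ_2 ≥ …`. -/
def sortedParts (μ : Nat.Partition n) : List ℕ := μ.parts.sort (· ≥ ·)

/-- The cells (boxes) of the Young diagram of `μ`, as (row, column) pairs (0-indexed). -/
def cells (μ : Nat.Partition n) : Finset (ℕ × ℕ) :=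
  (Finset.range n ×ˢ Finset.range n).filter fun p => p.2 < (sortedParts μ).getD p.1 0

/-- A standard Young tableau of shape `μ`, encoded by the function sending each entry
`m ∈ {0, …, n-1}` to the cell it occupies: the filling is bijective onto the cells of `μ`
and the entries increase along rows and down columns. -/
def IsSYT (μ : Nat.Partition n) (f : Fin n → ℕ × ℕ) : Prop :=
  (∀ p, p ∈ cells μ ↔ ∃ m, f m = p) ∧ Function.Injective f ∧
  (∀ m m' : Fin n, (f m).1 = (f m').1 → (f m).2 < (f m').2 → m < m') ∧
  (∀ m m' : Fin n, (f m).2 = (f m').2 → (f m).1 < (f m').1 → m < m')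

/-- `d(μ)`, the number of standard Young tableaux of shape `μ`. -/
noncomputable def sytCount (μ : Nat.Partition n) : ℕ :=
  Nat.card {f : Fin n → ℕ × ℕ // IsSYT μ f}

/-- The element `y_d = Σ_{τ ∈ S_{d+1}} sgn(τ) τ`, the sum over the subgroup of `S_n` of
permutations fixing (in 1-indexed terms) the points `d+2, …, n`. -/
noncomputable def yd (k : Type) [CommRing k] (n d : ℕ) : MonoidAlgebra k (Equiv.Perm (Fin n)) :=
  ∑ τ ∈ Finset.univ.filter (fun τ : Equiv.Perm (Fin n) => ∀ i : Fin n, d + 1 ≤ i.val → τ i = i),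
    MonoidAlgebra.single τ ((Equiv.Perm.sign τ : ℤ) : k)

/-- For `d < n`, the two-sided ideal `J(n,d)` of `k[S_n]` generated by `y_d`, viewed as a
`k`-submodule. -/
noncomputable def Jnd (k : Type) [CommRing k] (n d : ℕ) :
    Submodule k (MonoidAlgebra k (Equiv.Perm (Fin n))) :=
  Submodule.span k {x | ∃ a b : MonoidAlgebra k (Equiv.Perm (Fin n)), x = a * yd k n d * b}


def gr (b : ℕ → ℕ → ℕ) : ℕ → ℕ → ℕ → ℕ
  | 0, _, _ => 0
  | _ + 1, 0, _ => 0
  | i + 1, j + 1, 0 => max (gr b i (j+1) 0) (gr b (i+1) j 0) + b i j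
  | i + 1, j + 1, k + 1 => max (gr b i (j+1) (k+1)) (gr b (i+1) j (k+1)) +
      min (gr b i (j+1) k) (gr b (i+1) j k) - gr b i j k
termination_by i j => (i, j)

theorem gr_zero_left (b : ℕ → ℕ → ℕ) (j k : ℕ) : gr b 0 j k = 0 := by simp [gr]
theorem gr_zero_right (b : ℕ → ℕ → ℕ) (i k : ℕ) : gr b i 0 k = 0 := by
  cases i <;> simp [gr]
theorem gr_s0 (b : ℕ → ℕ → ℕ) (i j : ℕ) : gr b (i+1) (j+1) 0 =
    max (gr b i (j+1) 0) (gr b (i+1) j 0) + b i j := by rw [gr]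
theorem gr_ss (b : ℕ → ℕ → ℕ) (i j k : ℕ) : gr b (i+1) (j+1) (k+1) =
    max (gr b i (j+1) (k+1)) (gr b (i+1) j (k+1)) +
      min (gr b i (j+1) k) (gr b (i+1) j k) - gr b i j k := by rw [gr]

/-- interlacing -/
def Il (a b : ℕ → ℕ) : Prop := ∀ k, a k ≤ b k ∧ b (k+1) ≤ a k

theorem gr_step (b : ℕ → ℕ → ℕ) (i j : ℕ) (h1 : Il (gr b i j) (gr b (i+1) j))
    (h2 : Il (gr b i j) (gr b i (j+1))) :
    Il (gr b i (j+1)) (gr b (i+1) (j+1)) ∧ Il (gr b (i+1) j) (gr b (i+1) (j+1)) := by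
  have key : ∀ k, gr b i (j+1) k ≤ gr b (i+1) (j+1) k ∧ gr b (i+1) j k ≤ gr b (i+1) (j+1) k ∧
      gr b (i+1) (j+1) (k+1) ≤ gr b i (j+1) k ∧ gr b (i+1) (j+1) (k+1) ≤ gr b (i+1) j k := by
    intro k
    have e := gr_ss b i j k
    have a1 := h1 k; have a2 := h2 k
    have e2 : gr b i (j+1) k ≤ gr b (i+1) (j+1) k ∧ gr b (i+1) j k ≤ gr b (i+1) (j+1) k := by
      cases k with
      | zero => rw [gr_s0]; omega
      | succ k =>
        have e := gr_ss b i j k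
        have a1 := h1 k; have a2 := h2 k
        omega
    omega
  exact ⟨fun k => ⟨(key k).1, (key k).2.2.1⟩, fun k => ⟨(key k).2.1, (key k).2.2.2⟩⟩

theorem gr_il (b : ℕ → ℕ → ℕ) (i : ℕ) : (∀ j, Il (gr b i j) (gr b i (j+1))) ∧
    ∀ j, Il (gr b i j) (gr b (i+1) j) := by
  have main : ∀ i, (∀ j, Il (gr b i j) (gr b i (j+1))) → ∀ j, Il (gr b i j) (gr b (i+1) j) := by
    intro i hi j
    induction j with
    | zero => intro k; simp [gr_zero_right]
    | succ j ih => exact (gr_step b i j ih (hi j)).1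
  have h : ∀ j, Il (gr b i j) (gr b i (j+1)) := by
    induction i with
    | zero => intro j k; simp [gr_zero_left]
    | succ i ih => intro j; exact (gr_step b i j (main i ih j) (ih j)).2
  exact ⟨h, main i h⟩

/-- local growth relation -/
def Loc (x : ℕ) (r m v l : ℕ → ℕ) : Prop :=
  l 0 = max (m 0) (v 0) + x ∧ ∀ k, l (k+1) + r k = max (m (k+1)) (v (k+1)) + min (m k) (v k)

theorem gr_loc (b : ℕ → ℕ → ℕ) (i j : ℕ) :
    Loc (b i j) (gr b i j) (gr b i (j+1)) (gr b (i+1) j) (gr b (i+1) (j+1)) := by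
  refine ⟨gr_s0 b i j, fun k => ?_⟩
  have := (gr_il b i).1 j k
  have := (gr_il b i).2 j k
  have := gr_ss b i j k
  omega

theorem gr_congr {b b' : ℕ → ℕ → ℕ} {n : ℕ} (h : ∀ i j, i < n → j < n → b i j = b' i j) :
    ∀ i j, i ≤ n → j ≤ n → gr b i j = gr b' i j := by
  intro i
  induction i with
  | zero => intro j _ _; funext k; simp [gr_zero_left]
  | succ i ih =>
    intro j hi
    induction j with
    | zero => intro _; funext k; simp [gr_zero_right]
    | succ j jh =>
      intro hj
      funext k
      cases k with
      | zero => rw [gr_s0, gr_s0, ih _ (by omega) hj, jh (by omega), h i j (by omega) (by omega)]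
      | succ k => rw [gr_ss, gr_ss, ih _ (by omega) hj, jh (by omega), ih j (by omega) (by omega)]

/-- uniqueness: a system satisfying local rules and zero boundary is `gr`. -/
theorem eq_gr {b : ℕ → ℕ → ℕ} {n : ℕ} (Λ : ℕ → ℕ → ℕ → ℕ) (h0 : ∀ j k, j ≤ n → Λ 0 j k = 0)
    (h0' : ∀ i k, i ≤ n → Λ i 0 k = 0)
    (hl : ∀ i j, i < n → j < n → Loc (b i j) (Λ i j) (Λ i (j+1)) (Λ (i+1) j) (Λ (i+1) (j+1))) :
    ∀ i j, i ≤ n → j ≤ n → Λ i j = gr b i j := by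
  intro i
  induction i with
  | zero => intro j _ hj; funext k; simp [gr_zero_left, h0 j k hj]
  | succ i ih =>
    intro j hi
    induction j with
    | zero => intro _; funext k; simp [gr_zero_right, h0' _ k hi]
    | succ j jh =>
      intro hj
      have A := hl i j (by omega) (by omega)
      have B := gr_loc b i j
      rw [ih j (by omega) (by omega), ih (j+1) (by omega) hj, jh (by omega)] at A
      funext k
      cases k with
      | zero => rw [A.1, B.1]
      | succ k => have := A.2 k; have := B.2 k; omega

/-- backward uniqueness -/
theorem gr_inj {b b' : ℕ → ℕ → ℕ} {n : ℕ} (h1 : ∀ j, j ≤ n → gr b n j = gr b' n j)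
    (h2 : ∀ i, i ≤ n → gr b i n = gr b' i n) : ∀ i j, i < n → j < n → b i j = b' i j := by
  have key : ∀ p q, p ≤ n → q ≤ n → gr b (n-p) (n-q) = gr b' (n-p) (n-q) := by
    intro p
    induction p with
    | zero => intro q _ hq; exact h1 _ (by omega)
    | succ p ih =>
      intro q hp
      induction q with
      | zero => intro _; exact h2 _ (by omega)
      | succ q qh =>
        intro hq
        have A := gr_loc b (n-(p+1)) (n-(q+1))
        have B := gr_loc b' (n-(p+1)) (n-(q+1))
        have e1 : n - (p+1) + 1 = n - p := by omega
        have e2 : n - (q+1) + 1 = n - q := by omega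
        rw [e1, e2] at A B
        rw [ih q (by omega) (by omega), ih (q+1) (by omega) (by omega), qh (by omega)] at A
        funext k
        have := A.2 k; have := B.2 k; omega
  have key' : ∀ i j, i ≤ n → j ≤ n → gr b i j = gr b' i j := by
    intro i j hi hj
    have := key (n-i) (n-j) (by omega) (by omega)
    rwa [show n - (n-i) = i by omega, show n-(n-j) = j by omega] at this
  intro i j hi hj
  have A := (gr_loc b i j).1
  have B := (gr_loc b' i j).1
  rw [key' (i+1) (j+1) (by omega) (by omega), key' (i+1) j (by omega) (by omega),
    key' i (j+1) (by omega) (by omega)] at A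
  omega

def rv (n : ℕ) (C D : ℕ → ℕ → ℕ) : ℕ → ℕ → ℕ → ℕ
  | 0, j, k => C (n - j) k
  | i + 1, 0, k => D (n - (i+1)) k
  | i + 1, j + 1, k => max (rv n C D i (j+1) (k+1)) (rv n C D (i+1) j (k+1)) +
      min (rv n C D i (j+1) k) (rv n C D (i+1) j k) - rv n C D i j (k+1)
termination_by i j => (i, j)

theorem rv_ss (C D : ℕ → ℕ → ℕ) (i j k : ℕ) : rv n C D (i+1) (j+1) k =
  max (rv n C D i (j+1) (k+1)) (rv n C D (i+1) j (k+1)) +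
      min (rv n C D i (j+1) k) (rv n C D (i+1) j k) - rv n C D i j (k+1) := by rw [rv]

theorem rv_step (C D : ℕ → ℕ → ℕ) (i j : ℕ) (h1 : Il (rv n C D (i+1) j) (rv n C D i j))
    (h2 : Il (rv n C D i (j+1)) (rv n C D i j)) :
    Il (rv n C D (i+1) (j+1)) (rv n C D i (j+1)) ∧
      Il (rv n C D (i+1) (j+1)) (rv n C D (i+1) j) := by
  constructor <;> intro k <;> have := h1 k <;> have := h2 k <;> have := h1 (k+1) <;>
    have := h2 (k+1) <;> rw [rv_ss] <;> omega

theorem rv_zero_right (C D : ℕ → ℕ → ℕ) (h : C n = D n) (i : ℕ) :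
    rv n C D i 0 = D (n-i) := by
  funext k
  cases i with
  | zero => rw [rv]; simp [h]
  | succ i => rw [rv]

theorem rv_zero_left (C D : ℕ → ℕ → ℕ) (j : ℕ) :
    rv n C D 0 j = C (n-j) := by
  funext k
  rw [rv]

theorem rv_il (C D : ℕ → ℕ → ℕ) (h : C n = D n) (hC : ∀ k, k < n → Il (C k) (C (k+1)))
    (hD : ∀ k, k < n → Il (D k) (D (k+1))) (i : ℕ) (hi : i ≤ n) :
    (∀ j, j < n → Il (rv n C D i (j+1)) (rv n C D i j)) ∧
    (i < n → ∀ j, j ≤ n → Il (rv n C D (i+1) j) (rv n C D i j)) := by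
  have main : ∀ i, i < n → (∀ j, j < n → Il (rv n C D i (j+1)) (rv n C D i j)) →
     ∀ j, j ≤ n → Il (rv n C D (i+1) j) (rv n C D i j) := by
    intro i hin hi j
    induction j with
    | zero =>
      intro _
      rw [rv_zero_right C D h, rv_zero_right C D h]
      have := hD (n-(i+1)) (by omega)
      rwa [show n - (i+1) + 1 = n - i by omega] at this
    | succ j ih => intro hj; exact (rv_step C D i j (ih (by omega)) (hi j hj)).1
  have h : ∀ j, j < n → Il (rv n C D i (j+1)) (rv n C D i j) := by
    induction i with
    | zero =>
      intro j hj
      rw [rv_zero_left, rv_zero_left]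
      have := hC (n-(j+1)) (by omega)
      rwa [show n - (j+1) + 1 = n - j by omega] at this
    | succ i ih => intro j hj; exact (rv_step C D i j (main i (by omega) (ih (by omega)) j (by omega)) (ih (by omega) j hj)).2
  exact ⟨h, fun hin => main i hin h⟩

theorem exists_gr (C D : ℕ → ℕ → ℕ) (h : C n = D n) (hC : ∀ k, k < n → Il (C k) (C (k+1)))
    (hD : ∀ k, k < n → Il (D k) (D (k+1))) (hC0 : C 0 = 0) (hD0 : D 0 = 0) :
    ∃ b : ℕ → ℕ → ℕ, (∀ j, j ≤ n → gr b n j = C j) ∧ (∀ i, i ≤ n → gr b i n = D i) := by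
  let Λ : ℕ → ℕ → ℕ → ℕ := fun i j => rv n C D (n-i) (n-j)
  let b : ℕ → ℕ → ℕ := fun i j => Λ (i+1) (j+1) 0 - max (Λ i (j+1) 0) (Λ (i+1) j 0)
  have il1 : ∀ i j, i ≤ n → j < n → Il (Λ i j) (Λ i (j+1)) := by
    intro i j hi hj
    have := (rv_il C D h hC hD (n-i) (by omega)).1 (n-(j+1)) (by omega)
    rwa [show n - (j+1) + 1 = n - j by omega] at this
  have il2 : ∀ i j, i < n → j ≤ n → Il (Λ i j) (Λ (i+1) j) := by
    intro i j hi hj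
    have := (rv_il C D h hC hD (n-(i+1)) (by omega)).2 (by omega) (n-j) (by omega)
    rwa [show n - (i+1) + 1 = n - i by omega] at this
  have en : ∀ j, j ≤ n → Λ n j = C j := by
    intro j hj
    simp only [Λ, Nat.sub_self]
    rw [rv_zero_left, show n-(n-j) = j by omega]
  have en' : ∀ j, j ≤ n → Λ j n = D j := by
    intro j hj
    simp only [Λ, Nat.sub_self]
    rw [rv_zero_right C D h, show n-(n-j) = j by omega]
  have z1 : ∀ j k, j ≤ n → Λ 0 j k = 0 := by
    have : ∀ p k, p ≤ n → Λ 0 (n-p) k = 0 := by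
      intro p
      induction p with
      | zero => intro k _; simp only [Nat.sub_zero]; rw [en' 0 (by omega), hD0]; rfl
      | succ p ih =>
        intro k hp
        have A := il1 0 (n-(p+1)) (by omega) (by omega) k
        rw [show n - (p+1) + 1 = n - p by omega] at A
        have := ih k (by omega); omega
    intro j k hj
    have := this (n-j) k (by omega)
    rwa [show n - (n-j) = j by omega] at this
  have z2 : ∀ j k, j ≤ n → Λ j 0 k = 0 := by
    have : ∀ p k, p ≤ n → Λ (n-p) 0 k = 0 := by
      intro p
      induction p with
      | zero => intro k _; simp only [Nat.sub_zero]; rw [en 0 (by omega), hC0]; rfl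
      | succ p ih =>
        intro k hp
        have A := il2 (n-(p+1)) 0 (by omega) (by omega) k
        rw [show n - (p+1) + 1 = n - p by omega] at A
        have := ih k (by omega); omega
    intro j k hj
    have := this (n-j) k (by omega)
    rwa [show n - (n-j) = j by omega] at this
  have G := eq_gr (b := b) (n := n) Λ z1 z2 (by
    intro i j hi hj
    constructor
    · have := il1 (i+1) j (by omega) hj 0
      have := il2 i (j+1) hi (by omega) 0
      simp only [b]; omega
    · intro k
      have a1 := il1 (i+1) j (by omega) hj k
      have a2 := il2 i (j+1) hi (by omega) k
      have e := rv_ss (n := n) C D (n-(i+1)) (n-(j+1)) k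
      rw [show n - (i+1) + 1 = n - i by omega, show n - (j+1) + 1 = n - j by omega] at e
      change Λ i j k = max (Λ (i+1) j (k+1)) (Λ i (j+1) (k+1)) + min (Λ (i+1) j k) (Λ i (j+1) k) - Λ (i+1) (j+1) (k+1) at e
      omega)
  exact ⟨b, fun j hj => by rw [← G n j le_rfl hj, en j hj],
    fun i hi => by rw [← G i n hi le_rfl, en' i hi]⟩

theorem gr_supp (b : ℕ → ℕ → ℕ) (i j k : ℕ) (h : i ≤ k) : gr b i j k = 0 := by
  induction i generalizing k with
  | zero => exact gr_zero_left b j k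
  | succ i ih =>
    obtain ⟨k, rfl⟩ : ∃ k', k = k'+1 := ⟨k-1, by omega⟩
    have := ((gr_il b i).2 j k).2
    have := ih k (by omega)
    omega

def sz (n : ℕ) (a : ℕ → ℕ) : ℕ := ∑ k ∈ range (n+1), a k

theorem sz_loc {x : ℕ} {r m v l : ℕ → ℕ} (h : Loc x r m v l) (hr : r n = 0) (hm : m n = 0)
    (hv : v n = 0) : sz n l + sz n r = sz n m + sz n v + x := by
  have e1 : sz n l = ∑ k ∈ range n, l (k+1) + l 0 := sum_range_succ' _ _
  have e2 : sz n r = ∑ k ∈ range n, r k + r n := sum_range_succ _ _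
  have e3 : sz n m + sz n v = ∑ k ∈ range (n+1), max (m k) (v k) + ∑ k ∈ range (n+1), min (m k) (v k) := by
    unfold sz
    rw [← sum_add_distrib, ← sum_add_distrib]
    exact sum_congr rfl fun k _ => by omega
  have e4 := sum_range_succ' (fun k => max (m k) (v k)) n
  have e5 := sum_range_succ (fun k => min (m k) (v k)) n
  have e6 : ∑ k ∈ range n, l (k+1) + ∑ k ∈ range n, r k =
      ∑ k ∈ range n, max (m (k+1)) (v (k+1)) + ∑ k ∈ range n, min (m k) (v k) := by
    rw [← sum_add_distrib, ← sum_add_distrib]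
    exact sum_congr rfl fun k _ => h.2 k
  have := h.1
  omega

theorem sz_gr (b : ℕ → ℕ → ℕ) (i j : ℕ) (hi : i ≤ n) :
    sz n (gr b i j) = ∑ p ∈ range i, ∑ q ∈ range j, b p q := by
  induction i generalizing j with
  | zero => simp [sz, gr_zero_left]
  | succ i ih =>
    induction j with
    | zero => simp [sz, gr_zero_right]
    | succ j jh =>
      have := sz_loc (n := n) (gr_loc b i j) (gr_supp b _ _ _ (by omega)) (gr_supp b _ _ _ (by omega)) (gr_supp b _ _ _ (by omega))
      rw [ih j (by omega), ih (j+1) (by omega), jh, sum_range_succ _ i] at this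
      rw [sum_range_succ _ i, sum_range_succ _ j]
      omega

theorem sum_one {n : ℕ} {g : ℕ → ℕ} (h : ∑ q ∈ range n, g q = 1) :
    ∃ q, q < n ∧ g q = 1 ∧ ∀ q', q' < n → q' ≠ q → g q' = 0 := by
  have : ∃ q ∈ range n, g q ≠ 0 := by
    by_contra hc
    push Not at hc
    rw [sum_eq_zero hc] at h
    omega
  obtain ⟨q, hq, hg⟩ := this
  have e := add_sum_erase (range n) g hq
  refine ⟨q, mem_range.1 hq, by omega, fun q' hq' hne => ?_⟩
  have : ∑ x ∈ (range n).erase q, g x = 0 := by omega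
  exact (sum_eq_zero_iff.1 this) q' (mem_erase.2 ⟨hne, mem_range.2 hq'⟩)

/-- permutation matrix -/
noncomputable def pm (σ : Equiv.Perm (Fin n)) (i j : ℕ) : ℕ :=
  open Classical in if ∃ h : i < n, (σ ⟨i, h⟩).val = j then 1 else 0

theorem pm_inv (σ : Equiv.Perm (Fin n)) (i j : ℕ) : pm σ⁻¹ j i = pm σ i j := by
  unfold pm
  congr 1
  apply propext
  constructor
  · rintro ⟨h, rfl⟩
    refine ⟨Fin.is_lt _, ?_⟩
    simp
  · rintro ⟨h, rfl⟩
    refine ⟨Fin.is_lt _, ?_⟩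
    simp

theorem pm_row (σ : Equiv.Perm (Fin n)) (i : ℕ) (hi : i < n) : ∑ j ∈ range n, pm σ i j = 1 := by
  rw [sum_eq_single (σ ⟨i, hi⟩).val]
  · simp [pm, hi]
  · intro b _ hb
    simp only [pm]
    rw [if_neg]
    rintro ⟨h, h'⟩
    exact hb h'.symm
  · intro h
    simp at h

theorem pm_col (σ : Equiv.Perm (Fin n)) (j : ℕ) (hj : j < n) : ∑ i ∈ range n, pm σ i j = 1 := by
  rw [← pm_row σ⁻¹ j hj]
  exact sum_congr rfl fun i _ => (pm_inv σ i j).symm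

theorem pm_injective : Function.Injective (pm (n := n)) := by
  intro σ τ h
  ext i
  have : pm τ i.1 (σ i).1 = 1 := by rw [← h]; simp [pm]
  simp only [pm] at this
  split_ifs at this with h'
  exact h'.2.symm

theorem pm_congr_inj {σ τ : Equiv.Perm (Fin n)} (h : ∀ i j, i < n → j < n → pm σ i j = pm τ i j) :
    σ = τ := by
  ext i
  have : pm τ i.1 (σ i).1 = 1 := by rw [← h _ _ i.2 (σ i).2]; simp [pm]
  simp only [pm] at this
  split_ifs at this with h'
  exact h'.2.symm

theorem exists_pm {b : ℕ → ℕ → ℕ} (hr : ∀ i, i < n → ∑ j ∈ range n, b i j = 1)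
    (hc : ∀ j, j < n → ∑ i ∈ range n, b i j = 1) :
    ∃ σ : Equiv.Perm (Fin n), ∀ i j, i < n → j < n → pm σ i j = b i j := by
  have : ∀ i : Fin n, ∃ q : Fin n, b i q = 1 ∧ ∀ q', q' < n → q' ≠ q.1 → b i q' = 0 := by
    intro i
    obtain ⟨q, h1, h2⟩ := sum_one (hr i i.2)
    exact ⟨⟨q, h1⟩, h2⟩
  choose f hf1 hf2 using this
  have inj : Function.Injective f := by
    intro i i' hii
    obtain ⟨q, h1, h2, h3⟩ := sum_one (hc (f i) (f i).2)
    have A : i.1 = q := by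
      by_contra hne
      have := h3 i i.2 hne
      rw [hf1] at this; omega
    have B : i'.1 = q := by
      by_contra hne
      have := h3 i' i'.2 hne
      rw [hii, hf1] at this; omega
    ext; omega
  refine ⟨Equiv.ofBijective f (Finite.injective_iff_bijective.1 inj), ?_⟩
  intro i j hi hj
  simp only [pm, Equiv.ofBijective_apply]
  split_ifs with h
  · obtain ⟨_, rfl⟩ := h
    exact (hf1 ⟨i, hi⟩).symm
  · exact (hf2 ⟨i, hi⟩ j hj (fun hh => h ⟨hi, hh.symm⟩)).symm

/-- standard chains -/
structure SC (n : ℕ) (C : ℕ → ℕ → ℕ) : Prop where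
  zero : C 0 = 0
  il : ∀ k, k < n → Il (C k) (C (k+1))
  size : ∀ k, k ≤ n → sz n (C k) = k
  stable : ∀ k, n ≤ k → C k = C n

def TT (n : ℕ) : Type :=
  {p : (ℕ → ℕ → ℕ) × (ℕ → ℕ → ℕ) // SC n p.1 ∧ SC n p.2 ∧ p.1 n = p.2 n}

noncomputable def rsk (σ : Equiv.Perm (Fin n)) : TT n :=
  ⟨(fun k => gr (pm σ) n (min k n), fun k => gr (pm σ) (min k n) n), by
    refine ⟨⟨?_, ?_, ?_, ?_⟩, ⟨?_, ?_, ?_, ?_⟩, by simp⟩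
    · funext k; simp [gr_zero_right]
    · intro k hk
      have := (gr_il (pm σ) n).1 k
      simpa [show min k n = k by omega, show min (k+1) n = k+1 by omega] using this
    · intro k hk
      simp only [show min k n = k by omega]
      rw [sz_gr _ _ _ le_rfl, sum_comm, sum_congr rfl (g := fun _ => 1)]
      · simp
      · intro x hx
        have := mem_range.1 hx
        exact pm_col σ x (by omega)
    · intro k hk; simp [show min k n = n by omega]
    · funext k; simp [gr_zero_left]
    · intro k hk
      have := (gr_il (pm σ) k).2 n
      simpa [show min k n = k by omega, show min (k+1) n = k+1 by omega] using this
    · intro k hk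
      simp only [show min k n = k by omega]
      rw [sz_gr _ _ _ hk, sum_congr rfl (g := fun _ => 1)]
      · simp
      · intro x hx
        have := mem_range.1 hx
        exact pm_row σ x (by omega)
    · intro k hk; simp [show min k n = n by omega]⟩

theorem rsk_bij : Function.Bijective (rsk (n := n)) := by
  constructor
  · intro σ τ h
    have h' := congrArg Subtype.val h
    have h1 := congrFun (congrArg Prod.fst h')
    have h2 := congrFun (congrArg Prod.snd h')
    apply pm_congr_inj
    apply gr_inj
    · intro j hj
      have := h1 j
      simpa [rsk, show min j n = j by omega] using this
    · intro j hj
      have := h2 j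
      simpa [rsk, show min j n = j by omega] using this
  · rintro ⟨⟨C, D⟩, hC, hD, hCD⟩
    simp only at hC hD hCD
    obtain ⟨b, h1, h2⟩ := exists_gr C D hCD hC.il hD.il hC.zero hD.zero
    have r : ∀ i, i < n → ∑ j ∈ range n, b i j = 1 := by
      intro i hi
      have A := hD.size i (by omega)
      have B := hD.size (i+1) (by omega)
      rw [← h2 _ (by omega), sz_gr _ _ _ (by omega)] at A B
      rw [sum_range_succ] at B
      omega
    have c : ∀ i, i < n → ∑ j ∈ range n, b j i = 1 := by
      intro i hi
      have A := hC.size i (by omega)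
      have B := hC.size (i+1) (by omega)
      rw [← h1 _ (by omega), sz_gr _ _ _ (by omega), sum_comm] at A B
      rw [sum_range_succ] at B
      omega
    obtain ⟨σ, hσ⟩ := exists_pm r c
    have G := gr_congr hσ
    refine ⟨σ, Subtype.ext (Prod.ext ?_ ?_)⟩
    · funext k
      simp only [rsk]
      rw [G _ _ le_rfl (by omega), h1 _ (by omega)]
      rcases le_total k n with h | h
      · rw [min_eq_left h]
      · rw [min_eq_right h, hC.stable k h]
    · funext k
      simp only [rsk]
      rw [G _ _ (by omega) le_rfl, h2 _ (by omega)]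
      rcases le_total k n with h | h
      · rw [min_eq_left h]
      · rw [min_eq_right h, hD.stable k h]

/-- longest increasing subsequence length -/
noncomputable def lis (σ : Equiv.Perm (Fin n)) : ℕ := gr (pm σ) n n 0

theorem gr_mono (b : ℕ → ℕ → ℕ) {i i' j j' : ℕ} (hi : i ≤ i') (hj : j ≤ j') (k : ℕ) :
    gr b i j k ≤ gr b i' j' k := by
  have A : Monotone fun i => gr b i j k := monotone_nat_of_le_succ fun i => ((gr_il b i).2 j k).1
  have B : Monotone fun j => gr b i' j k := monotone_nat_of_le_succ fun j => ((gr_il b i').1 j k).1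
  exact (A hi).trans (B hj)

theorem exists_color (σ : Equiv.Perm (Fin n)) (d : ℕ) (h : lis σ ≤ d) :
    ∃ c : Fin n → Fin d, ∀ i j, c i = c j → i < j → σ j < σ i := by
  have key : ∀ i : Fin n, gr (pm σ) i (σ i) 0 + 1 ≤ gr (pm σ) (i+1) (σ i+1) 0 := by
    intro i
    rw [gr_s0]
    have : pm σ i (σ i) = 1 := by simp [pm]
    have := gr_mono (pm σ) (le_refl i.1) (Nat.le_succ (σ i).1) 0
    simp only [Nat.succ_eq_add_one] at this
    omega
  refine ⟨fun i => ⟨gr (pm σ) i (σ i) 0, ?_⟩, ?_⟩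
  · have := gr_mono (pm σ) (show i.1+1 ≤ n by omega) (show (σ i).1+1 ≤ n by omega) 0
    have := key i
    unfold lis at h
    omega
  · intro i j hc hij
    by_contra hlt
    have hne : σ i ≠ σ j := fun e => hij.ne (σ.injective e)
    have hlt' : σ i < σ j := lt_of_le_of_ne (not_lt.1 hlt) hne
    have := gr_mono (pm σ) (show i.1+1 ≤ j by exact hij) (show (σ i).1+1 ≤ σ j by exact hlt') 0
    have := key i
    have hc := congrArg Fin.val hc
    simp only at hc
    omega

theorem exists_incr (σ : Equiv.Perm (Fin n)) (i j : ℕ) :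
    ∃ I : Finset (Fin n), I.card = gr (pm σ) i j 0 ∧ (∀ x ∈ I, x.1 < i ∧ (σ x).1 < j) ∧
      ∀ x ∈ I, ∀ y ∈ I, x < y → σ x < σ y := by
  induction i generalizing j with
  | zero => exact ⟨∅, by simp [gr_zero_left], by simp, by simp⟩
  | succ i ih =>
    induction j with
    | zero => exact ⟨∅, by simp [gr_zero_right], by simp, by simp⟩
    | succ j jh =>
      rw [gr_s0]
      by_cases hp : ∃ h : i < n, (σ ⟨i, h⟩).val = j
      · obtain ⟨h, hj⟩ := hp
        have hz : pm σ i j = 1 := by simp only [pm]; rw [if_pos ⟨h, hj⟩]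
        have : ∃ I : Finset (Fin n), I.card = max (gr (pm σ) i (j+1) 0) (gr (pm σ) (i+1) j 0) ∧
            (∀ x ∈ I, x.1 < i ∧ (σ x).1 < j) ∧ ∀ x ∈ I, ∀ y ∈ I, x < y → σ x < σ y := by
          rcases le_total (gr (pm σ) i (j+1) 0) (gr (pm σ) (i+1) j 0) with hle | hle
          · rw [max_eq_right hle]
            obtain ⟨I, h1, h2, h3⟩ := jh
            refine ⟨I, h1, fun x hx => ⟨?_, (h2 x hx).2⟩, h3⟩
            have hx1 := (h2 x hx).1
            have hx2 := (h2 x hx).2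
            by_contra hc
            have : x = ⟨i, h⟩ := Fin.ext (by simp only; omega)
            rw [this] at hx2
            omega
          · rw [max_eq_left hle]
            obtain ⟨I, h1, h2, h3⟩ := ih (j+1)
            refine ⟨I, h1, fun x hx => ⟨(h2 x hx).1, ?_⟩, h3⟩
            have hx1 := (h2 x hx).1
            have hx2 := (h2 x hx).2
            by_contra hc
            have e : σ x = σ ⟨i, h⟩ := Fin.ext (by omega)
            have := congrArg Fin.val (σ.injective e)
            simp only at this
            omega
        obtain ⟨I, h1, h2, h3⟩ := this
        refine ⟨insert ⟨i, h⟩ I, ?_, ?_, ?_⟩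
        · rw [card_insert_of_notMem, h1, hz]
          intro hm
          have := (h2 _ hm).1
          simp at this
        · intro x hx
          rcases mem_insert.1 hx with rfl | hx
          · simp only; omega
          · have := h2 x hx; omega
        · intro x hx y hy hxy
          rcases mem_insert.1 hx with rfl | hx
          · rcases mem_insert.1 hy with rfl | hy
            · exact absurd hxy (lt_irrefl _)
            · have := (h2 y hy).1
              have := Fin.lt_def.1 hxy
              simp only at this; omega
          · rcases mem_insert.1 hy with rfl | hy
            · have := (h2 x hx).2
              rw [Fin.lt_def]; omega
            · exact h3 x hx y hy hxy
      · have hz : pm σ i j = 0 := by simp only [pm]; rw [if_neg hp]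
        rw [hz, add_zero]
        rcases le_total (gr (pm σ) i (j+1) 0) (gr (pm σ) (i+1) j 0) with hle | hle
        · rw [max_eq_right hle]
          obtain ⟨I, h1, h2, h3⟩ := jh
          exact ⟨I, h1, fun x hx => ⟨(h2 x hx).1, by have := (h2 x hx).2; omega⟩, h3⟩
        · rw [max_eq_left hle]
          obtain ⟨I, h1, h2, h3⟩ := ih (j+1)
          exact ⟨I, h1, fun x hx => ⟨by have := (h2 x hx).1; omega, (h2 x hx).2⟩, h3⟩

theorem perm_first {π : Equiv.Perm (Fin n)} (h : π ≠ 1) :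
    ∃ i, i < π i ∧ ∀ j, j < i → π j = j := by
  have hne : (univ.filter fun i => π i ≠ i).Nonempty := by
    by_contra hc
    rw [not_nonempty_iff_eq_empty, filter_eq_empty_iff] at hc
    apply h
    ext i
    have := hc (mem_univ i)
    simp only [ne_eq, not_not] at this
    simp [this]
  obtain ⟨i, hi, hmin⟩ := exists_min_image _ id hne
  simp only [mem_filter, mem_univ, true_and, id] at hi hmin
  have hlt : ∀ j, j < i → π j = j := by
    intro j hj
    by_contra hc
    exact absurd (hmin j hc) (not_le.2 hj)
  refine ⟨i, ?_, hlt⟩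
  rcases lt_trichotomy (π i) i with hl | hl | hl
  · exact absurd (π.injective (hlt _ hl)) hi
  · exact absurd hl hi
  · exact hl

def key (σ : Equiv.Perm (Fin n)) : Lex (Fin n → Fin n) := toLex (fun i => σ i)

theorem key_lt {σ τ : Equiv.Perm (Fin n)} (i : Fin n) (h : ∀ j, j < i → σ j = τ j)
    (h' : σ i < τ i) : key σ < key τ := ⟨i, h, h'⟩

/-- functional -/
noncomputable def psi {d : ℕ} (c c' : Fin n → Fin d) :
    MonoidAlgebra ℂ (Equiv.Perm (Fin n)) →ₗ[ℂ] ℂ :=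
  (MonoidAlgebra.basis (Equiv.Perm (Fin n)) ℂ).constr ℂ
    (fun τ => if ∀ i, c' (τ i) = c i then 1 else 0)

theorem psi_single {d : ℕ} (c c' : Fin n → Fin d) (τ : Equiv.Perm (Fin n)) (r : ℂ) :
    psi c c' (MonoidAlgebra.single τ r) = if ∀ i, c' (τ i) = c i then r else 0 := by
  have : MonoidAlgebra.single τ r = r • MonoidAlgebra.basis (Equiv.Perm (Fin n)) ℂ τ := by
    simp [MonoidAlgebra.basis_apply]
  rw [this, map_smul, psi, Module.Basis.constr_basis]
  split_ifs <;> simp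

theorem psi_yd {d : ℕ} (hdn : d < n) (c c' : Fin n → Fin d) (α β : Equiv.Perm (Fin n)) (r s : ℂ) :
    psi c c' (MonoidAlgebra.single α r * yd ℂ n d * MonoidAlgebra.single β s) = 0 := by
  -- two equal colours
  obtain ⟨k, l, hkl, hc⟩ : ∃ k l : Fin (d+1), k ≠ l ∧
      c' (α ⟨k, by omega⟩) = c' (α ⟨l, by omega⟩) :=
    Fintype.exists_ne_map_eq_of_card_lt (fun k : Fin (d+1) => c' (α ⟨k, by omega⟩)) (by simp)
  set k' : Fin n := ⟨k, by omega⟩ with hk'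
  set l' : Fin n := ⟨l, by omega⟩ with hl'
  have hne : k' ≠ l' := by
    intro h
    apply hkl
    have := congrArg Fin.val h
    exact Fin.ext this
  have hsw : ∀ x, c' (α (Equiv.swap k' l' x)) = c' (α x) := by
    intro x
    by_cases h1 : x = k'
    · rw [h1, Equiv.swap_apply_left, hc]
    · by_cases h2 : x = l'
      · rw [h2, Equiv.swap_apply_right, hc]
      · rw [Equiv.swap_apply_of_ne_of_ne h1 h2]
  simp only [yd, mul_sum, sum_mul, MonoidAlgebra.single_mul_single, map_sum, psi_single]
  refine sum_involution (fun π _ => Equiv.swap k' l' * π) ?_ ?_ ?_ ?_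
  · intro π _
    have : (∀ i, c' ((α * (Equiv.swap k' l' * π) * β) i) = c i) ↔ ∀ i, c' ((α * π * β) i) = c i := by
      simp only [Equiv.Perm.mul_apply, hsw]
    simp only [this, Equiv.Perm.sign_mul, Equiv.Perm.sign_swap hne]
    split_ifs <;> simp
  · intro π _ _ h
    have : Equiv.swap k' l' = 1 := by simpa using h
    exact hne (Equiv.swap_eq_one_iff.1 this)
  · intro π hπ
    simp only [mem_filter, mem_univ, true_and] at hπ ⊢
    intro i hi
    rw [Equiv.Perm.mul_apply, hπ i hi]
    apply Equiv.swap_apply_of_ne_of_ne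
    · intro h; rw [h] at hi; simp only [hk'] at hi; omega
    · intro h; rw [h] at hi; simp only [hl'] at hi; omega
  · intro π _
    simp

theorem psi_Jnd {d : ℕ} (hdn : d < n) (c c' : Fin n → Fin d)
    {x : MonoidAlgebra ℂ (Equiv.Perm (Fin n))} (hx : x ∈ Jnd ℂ n d) : psi c c' x = 0 := by
  have : Jnd ℂ n d ≤ LinearMap.ker (psi c c') := by
    rw [Jnd, Submodule.span_le]
    rintro _ ⟨a, b, rfl⟩
    simp only [SetLike.mem_coe, LinearMap.mem_ker]
    induction a using MonoidAlgebra.induction_linear with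
    | zero => simp
    | add a a' h h' => rw [add_mul, add_mul, map_add, h, h', add_zero]
    | single α r =>
      induction b using MonoidAlgebra.induction_linear with
      | zero => simp
      | add a a' h h' => rw [mul_add, map_add, h, h', add_zero]
      | single β s => exact psi_yd hdn c c' α β r s
  exact this hx

noncomputable def WW (n d : ℕ) : Submodule ℂ (MonoidAlgebra ℂ (Equiv.Perm (Fin n))) :=
  Submodule.span ℂ (Set.range fun σ : {σ : Equiv.Perm (Fin n) // lis σ ≤ d} =>
    MonoidAlgebra.basis (Equiv.Perm (Fin n)) ℂ σ.1)

theorem WW_supp {d : ℕ} {x : MonoidAlgebra ℂ (Equiv.Perm (Fin n))} (hx : x ∈ WW n d)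
    (σ : Equiv.Perm (Fin n)) (h : (MonoidAlgebra.basis (Equiv.Perm (Fin n)) ℂ).repr x σ ≠ 0) :
    lis σ ≤ d := by
  have e : (Set.range fun σ : {σ : Equiv.Perm (Fin n) // lis σ ≤ d} =>
    MonoidAlgebra.basis (Equiv.Perm (Fin n)) ℂ σ.1) =
      (MonoidAlgebra.basis (Equiv.Perm (Fin n)) ℂ) '' {σ | lis σ ≤ d} := by
    ext y; simp
  rw [WW, e, Module.Basis.mem_span_image] at hx
  exact hx (Finsupp.mem_support_iff.2 h)

theorem disj {d : ℕ} (hdn : d < n) : Disjoint (Jnd ℂ n d) (WW n d) := by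
  rw [Submodule.disjoint_def]
  intro x hJ hW
  set B := MonoidAlgebra.basis (Equiv.Perm (Fin n)) ℂ with hB
  by_contra hx
  have hne : (B.repr x).support.Nonempty := by
    rw [Finsupp.support_nonempty_iff]
    simpa using hx
  obtain ⟨σ, hσ, hmin⟩ := exists_min_image _ key hne
  rw [Finsupp.mem_support_iff] at hσ
  obtain ⟨c, hc⟩ := exists_color σ d (WW_supp hW σ hσ)
  have h0 := psi_Jnd hdn c (fun i => c (σ⁻¹ i)) hJ
  rw [psi, Module.Basis.constr_apply_fintype] at h0
  rw [sum_eq_single σ] at h0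
  · simp at h0
    exact hσ h0
  · intro τ _ hτ
    by_cases hz : B.repr x τ = 0
    · simp [← hB, hz]
    · rw [if_neg, smul_zero]
      intro hcol
      have hne : σ⁻¹ * τ ≠ 1 := fun h => hτ (inv_mul_eq_one.1 h).symm
      obtain ⟨i, hi, hj⟩ := perm_first hne
      have hk : key τ < key σ := by
        refine key_lt i (fun j hji => ?_) ?_
        · have := hj j hji
          rw [Equiv.Perm.mul_apply, Equiv.Perm.inv_eq_iff_eq] at this
          exact this
        · have := hc i _ (hcol i).symm hi
          simpa using this
      exact absurd (hmin τ (Finsupp.mem_support_iff.2 hz)) (not_le.2 hk)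
  · simp

theorem span_top {d : ℕ} (hdn : d < n) : Jnd ℂ n d ⊔ WW n d = ⊤ := by
  set B := MonoidAlgebra.basis (Equiv.Perm (Fin n)) ℂ with hB
  suffices h : ∀ σ, B σ ∈ Jnd ℂ n d ⊔ WW n d by
    rw [eq_top_iff, ← B.span_eq, Submodule.span_le]
    rintro _ ⟨σ, rfl⟩
    exact h σ
  intro σ
  induction hk : key σ using WellFoundedGT.induction generalizing σ with
  | ind k ih =>
    subst hk
    by_cases hl : lis σ ≤ d
    · exact Submodule.mem_sup_right (Submodule.subset_span ⟨⟨σ, hl⟩, rfl⟩)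
    · obtain ⟨I, hI1, -, hI3⟩ := exists_incr σ n n
      obtain ⟨I', hI', hcard⟩ := exists_subset_card_eq (show d + 1 ≤ I.card by
        rw [hI1]; unfold lis at hl; omega)
      have e : {x : Fin n // x.1 < d+1} ≃ {x // x ∈ I'} := by
        apply Fintype.equivOfCardEq
        rw [Fintype.card_coe, hcard, Fintype.card_subtype]
        rw [show (univ.filter fun x : Fin n => x.1 < d+1) = univ.map (Fin.castLEEmb (show d+1 ≤ n by omega)) by
          ext x
          simp only [mem_filter, mem_univ, true_and, mem_map, Fin.castLEEmb_apply]
          constructor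
          · intro h; exact ⟨⟨x, h⟩, rfl⟩
          · rintro ⟨y, rfl⟩; simp only [Fin.val_castLE]; omega]
        simp
      set γ := e.extendSubtype with hγ
      have hm : ∀ x : Fin n, x.1 < d+1 → γ x ∈ I := fun x hx => hI' (e.extendSubtype_mem x hx)
      have hJ : MonoidAlgebra.single (σ * γ) (1:ℂ) * yd ℂ n d * MonoidAlgebra.single γ⁻¹ 1 ∈
        Jnd ℂ n d := Submodule.subset_span ⟨_, _, rfl⟩
      simp only [yd, mul_sum, sum_mul, MonoidAlgebra.single_mul_single, one_mul, mul_one] at hJ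
      rw [← add_sum_erase _ _ (show (1 : Equiv.Perm (Fin n)) ∈ _ by simp)] at hJ
      have e1 : MonoidAlgebra.single (σ * γ * 1 * γ⁻¹) (((Equiv.Perm.sign (1 : Equiv.Perm (Fin n)) : ℤ)) : ℂ) = B σ := by
        simp [hB, MonoidAlgebra.basis_apply]
      rw [e1] at hJ
      have hS : ∑ x ∈ ({τ : Equiv.Perm (Fin n) | ∀ i : Fin n, d + 1 ≤ i.val → τ i = i} : Finset _).erase 1,
          MonoidAlgebra.single (σ * γ * x * γ⁻¹) (((Equiv.Perm.sign x : ℤ)) : ℂ) ∈ Jnd ℂ n d ⊔ WW n d := by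
        refine Submodule.sum_mem _ fun π hπ => ?_
        simp only [mem_erase, mem_filter, mem_univ, true_and] at hπ
        have : MonoidAlgebra.single (σ * γ * π * γ⁻¹) (((Equiv.Perm.sign π : ℤ)) : ℂ) =
          (((Equiv.Perm.sign π : ℤ)) : ℂ) • B (σ * γ * π * γ⁻¹) := by
          simp [hB, MonoidAlgebra.basis_apply]
        rw [this]
        refine Submodule.smul_mem _ _ (ih _ ?_ _ rfl)
        have hne : γ * π * γ⁻¹ ≠ 1 := by
          intro h
          apply hπ.1
          simpa using h
        have hfix : ∀ x, x ∉ I → (γ * π * γ⁻¹) x = x := by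
          intro x hx
          have : π (γ⁻¹ x) = γ⁻¹ x := by
            apply hπ.2
            by_contra hc
            apply hx
            have := hm (γ⁻¹ x) (by omega)
            simpa using this
          rw [Equiv.Perm.mul_apply, Equiv.Perm.mul_apply, this]
          simp
        obtain ⟨i, hi, hj⟩ := perm_first hne
        have hiI : i ∈ I := by
          by_contra hc
          rw [hfix i hc] at hi
          exact lt_irrefl _ hi
        have hiI' : (γ * π * γ⁻¹) i ∈ I := by
          by_contra hc
          have := (γ * π * γ⁻¹).injective (hfix _ hc)
          rw [this] at hi
          exact lt_irrefl _ hi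
        refine key_lt i ?_ ?_
        · intro j hji
          have := hj j hji
          simp only [Equiv.Perm.mul_apply] at this ⊢
          rw [this]
        · exact hI3 i hiI _ hiI' hi
      have := Submodule.sub_mem _ (Submodule.mem_sup_left (T := WW n d) hJ) hS
      simpa using this

theorem finrank_WW (d : ℕ) : Module.finrank ℂ (WW n d) =
    Nat.card {σ : Equiv.Perm (Fin n) // lis σ ≤ d} := by
  rw [Nat.card_eq_fintype_card]
  exact finrank_span_eq_card ((MonoidAlgebra.basis (Equiv.Perm (Fin n)) ℂ).linearIndependent.comp _
    Subtype.val_injective)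

theorem finrank_quot {d : ℕ} (hdn : d < n) :
    Module.finrank ℂ (MonoidAlgebra ℂ (Equiv.Perm (Fin n)) ⧸ Jnd ℂ n d) =
    Nat.card {σ : Equiv.Perm (Fin n) // lis σ ≤ d} := by
  rw [← finrank_WW]
  exact (Submodule.quotientEquivOfIsCompl _ _ ⟨disj hdn, codisjoint_iff.2 (span_top hdn)⟩).finrank_eq

theorem finrank_J {d : ℕ} (hdn : d < n) :
    Module.finrank ℂ (Jnd ℂ n d) =
    Nat.card {σ : Equiv.Perm (Fin n) // ¬ lis σ ≤ d} := by
  have : Module.Finite ℂ (MonoidAlgebra ℂ (Equiv.Perm (Fin n))) :=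
    Module.Finite.of_basis (MonoidAlgebra.basis (Equiv.Perm (Fin n)) ℂ)
  have h1 := Submodule.finrank_quotient_add_finrank (Jnd ℂ n d)
  rw [finrank_quot hdn, Module.finrank_eq_nat_card_basis (MonoidAlgebra.basis (Equiv.Perm (Fin n)) ℂ)] at h1
  have h2 : Nat.card (Equiv.Perm (Fin n)) = Nat.card {σ : Equiv.Perm (Fin n) // lis σ ≤ d} +
      Nat.card {σ : Equiv.Perm (Fin n) // ¬ lis σ ≤ d} := by
    rw [← Nat.card_sum]
    exact Nat.card_congr (Equiv.sumCompl _).symm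
  omega

def row (μ : Nat.Partition n) (r : ℕ) : ℕ := (sortedParts μ).getD r 0

theorem length_sp (μ : Nat.Partition n) : (sortedParts μ).length = Multiset.card μ.parts :=
  Multiset.length_sort ..

theorem sp_pos (μ : Nat.Partition n) : ∀ x ∈ sortedParts μ, 0 < x := by
  intro x hx
  exact μ.parts_pos ((Multiset.mem_sort _).1 hx)

theorem row_eq (μ : Nat.Partition n) (r : ℕ) (h : r < (sortedParts μ).length) :
    row μ r = (sortedParts μ)[r] := by
  simp [row, h]

theorem row_pos (μ : Nat.Partition n) (r : ℕ) : 0 < row μ r ↔ r < Multiset.card μ.parts := by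
  rw [← length_sp]
  constructor
  · intro h
    by_contra hc
    rw [row, List.getD_eq_default _ _ (not_lt.1 hc)] at h
    exact lt_irrefl _ h
  · intro h
    rw [row_eq μ r h]
    exact sp_pos μ _ (List.getElem_mem h)

theorem row_le (μ : Nat.Partition n) (r : ℕ) : row μ r ≤ n := by
  by_cases h : r < (sortedParts μ).length
  · rw [row_eq μ r h]
    exact Nat.Partition.le_of_mem_parts ((Multiset.mem_sort _).1 (List.getElem_mem h))
  · rw [row, List.getD_eq_default _ _ (not_lt.1 h)]
    exact Nat.zero_le _

theorem card_parts_le (μ : Nat.Partition n) : Multiset.card μ.parts ≤ n := by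
  have := Multiset.card_nsmul_le_sum (s := μ.parts) (a := 1) (fun x hx => μ.parts_pos hx)
  rw [μ.parts_sum] at this
  simpa using this

theorem row_anti (μ : Nat.Partition n) {r r' : ℕ} (h : r ≤ r') : row μ r' ≤ row μ r := by
  by_cases h' : r' < (sortedParts μ).length
  · rw [row_eq μ r' h', row_eq μ r (by omega)]
    rcases h.eq_or_lt with rfl | hlt
    · exact le_rfl
    · exact List.pairwise_iff_getElem.1 (Multiset.pairwise_sort μ.parts (· ≥ ·)) r r' _ _ hlt
  · rw [row, List.getD_eq_default _ _ (not_lt.1 h')]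
    exact Nat.zero_le _

theorem mem_cells' (μ : Nat.Partition n) (p : ℕ × ℕ) : p ∈ cells μ ↔ p.2 < row μ p.1 := by
  unfold cells
  rw [mem_filter, mem_product, mem_range, mem_range]
  constructor
  · exact fun h => h.2
  · intro h
    refine ⟨⟨?_, ?_⟩, h⟩
    · have := (row_pos μ p.1).1 (by omega)
      have := card_parts_le μ
      omega
    · have := row_le μ p.1
      omega

theorem list_eq : ∀ (l l' : List ℕ), (∀ x ∈ l, 0 < x) → (∀ x ∈ l', 0 < x) →
    (∀ r, l.getD r 0 = l'.getD r 0) → l = l'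
  | [], [], _, _, _ => rfl
  | [], b :: t, _, h2, h => by
    have := h 0
    have := h2 b (by simp)
    simp at *; omega
  | b :: t, [], h2, _, h => by
    have := h 0
    have := h2 b (by simp)
    simp at *; omega
  | a :: s, b :: t, h1, h2, h => by
    have e0 := h 0
    simp only [List.getD_cons_zero] at e0
    rw [e0, list_eq s t (fun x hx => h1 x (by simp [hx])) (fun x hx => h2 x (by simp [hx]))
      (fun r => by simpa using h (r+1))]

theorem part_ext {μ ν : Nat.Partition n} (h : ∀ r c, c < row μ r ↔ c < row ν r) : μ = ν := by
  have e : sortedParts μ = sortedParts ν := by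
    apply list_eq _ _ (sp_pos μ) (sp_pos ν)
    intro r
    change row μ r = row ν r
    have h1 := h r (row μ r)
    have h2 := h r (row ν r)
    omega
  apply Nat.Partition.ext
  rw [← Multiset.sort_eq μ.parts (· ≥ ·), ← Multiset.sort_eq ν.parts (· ≥ ·)]
  exact congrArg _ e

def cf (f : Fin n → ℕ × ℕ) (k c : ℕ) : ℕ := #{m : Fin n | m.1 < k ∧ (f m).2 = c}

theorem cf_succ (f : Fin n → ℕ × ℕ) (m : Fin n) (c : ℕ) :
    cf f (m.1+1) c = cf f m.1 c + if c = (f m).2 then 1 else 0 := by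
  unfold cf
  split_ifs with h
  · rw [← card_insert_of_notMem (a := m) (by simp)]
    congr 1
    ext x
    simp only [mem_filter, mem_univ, true_and, mem_insert, Fin.ext_iff]
    constructor
    · rintro ⟨h1, h2⟩
      by_cases hx : x.1 = m.1
      · exact Or.inl hx
      · exact Or.inr ⟨by omega, h2⟩
    · rintro (h1 | ⟨h1, h2⟩)
      · rw [Fin.ext h1]
        exact ⟨by omega, h.symm⟩
      · exact ⟨by omega, h2⟩
  · rw [add_zero]
    congr 1
    ext x
    simp only [mem_filter, mem_univ, true_and]
    constructor
    · rintro ⟨h1, h2⟩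
      refine ⟨?_, h2⟩
      have : x ≠ m := by rintro rfl; exact h h2.symm
      have : x.1 ≠ m.1 := fun e => this (Fin.ext e)
      omega
    · rintro ⟨h1, h2⟩
      exact ⟨by omega, h2⟩

theorem syt_lt {μ : Nat.Partition n} {f : Fin n → ℕ × ℕ} (hf : IsSYT μ f) (m : Fin n) :
    (f m).2 < row μ (f m).1 := (mem_cells' μ _).1 ((hf.1 _).2 ⟨m, rfl⟩)

theorem cf_SC {μ : Nat.Partition n} {f : Fin n → ℕ × ℕ} (hf : IsSYT μ f) : SC n (cf f) where
  zero := by funext c; simp [cf]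
  il := by
    intro k hk c
    constructor
    · rw [cf_succ f ⟨k, hk⟩ c]; simp
    · have : ∀ m : Fin n, (f m).2 = c + 1 → ∃ m' : Fin n, f m' = ((f m).1, c) := by
        intro m hm
        apply (hf.1 _).1
        rw [mem_cells']
        have := syt_lt hf m
        simp only
        omega
      choose! g hg using this
      apply card_le_card_of_injOn g
      · intro m hm
        simp only [coe_filter, mem_univ, true_and, Set.mem_ofPred_eq] at hm ⊢
        have e := hg m hm.2
        refine ⟨?_, by rw [e]⟩
        have := hf.2.2.1 (g m) m (by rw [e]) (by rw [e]; simp only; omega)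
        have := Fin.lt_def.1 this
        omega
      · intro m hm m' hm' hmm
        simp only [coe_filter, mem_univ, true_and, Set.mem_ofPred_eq] at hm hm'
        have e := hg m hm.2
        have e' := hg m' hm'.2
        rw [hmm, e'] at e
        apply hf.2.1
        apply Prod.ext
        · exact (congrArg Prod.fst e).symm
        · rw [hm.2, hm'.2]
  size := by
    intro k hk
    unfold sz cf
    have := card_eq_sum_card_fiberwise (f := fun m : Fin n => (f m).2)
      (s := univ.filter fun m : Fin n => m.1 < k) (t := range (n+1)) (by
        intro m _
        have := syt_lt hf m
        have := row_le μ (f m).1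
        simp; omega)
    simp only [filter_filter] at this
    rw [← this]
    rw [show (univ.filter fun x : Fin n => x.1 < k) = univ.map (Fin.castLEEmb hk) by
          ext x
          simp only [mem_filter, mem_univ, true_and, mem_map, Fin.castLEEmb_apply]
          constructor
          · intro h; exact ⟨⟨x, h⟩, rfl⟩
          · rintro ⟨y, rfl⟩; simp only [Fin.val_castLE]; omega]
    simp
  stable := by
    intro k hk
    funext c
    unfold cf
    congr 1
    ext m
    simp only [mem_filter, mem_univ, true_and]
    have := m.2
    constructor <;> rintro ⟨_, h⟩ <;> exact ⟨by omega, h⟩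

theorem cf_n {μ : Nat.Partition n} {f : Fin n → ℕ × ℕ} (hf : IsSYT μ f) (c : ℕ) :
    cf f n c = #((cells μ).filter fun p => p.2 = c) := by
  unfold cf
  rw [← card_image_of_injective _ hf.2.1]
  congr 1
  ext p
  simp only [mem_image, mem_filter, mem_univ, true_and, hf.1]
  constructor
  · rintro ⟨m, ⟨_, h⟩, rfl⟩
    exact ⟨⟨m, rfl⟩, h⟩
  · rintro ⟨⟨m, rfl⟩, h⟩
    exact ⟨m, ⟨m.2, h⟩, rfl⟩

theorem cf_n_zero {μ : Nat.Partition n} {f : Fin n → ℕ × ℕ} (hf : IsSYT μ f) :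
    cf f n 0 = Multiset.card μ.parts := by
  rw [cf_n hf]
  rw [show (cells μ).filter (fun p => p.2 = 0) = (range (Multiset.card μ.parts)).image (fun r => (r, 0)) by
    ext ⟨r, c⟩
    simp only [mem_filter, mem_cells', mem_image, mem_range, Prod.mk.injEq]
    constructor
    · rintro ⟨h, rfl⟩
      exact ⟨r, (row_pos μ r).1 h, rfl, rfl⟩
    · rintro ⟨r, h, rfl, rfl⟩
      exact ⟨(row_pos μ r).2 h, rfl⟩]
  rw [card_image_of_injective _ (fun a b h => by simpa using h), card_range]

theorem syt_fst {μ : Nat.Partition n} {f : Fin n → ℕ × ℕ} (hf : IsSYT μ f) (m : Fin n) :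
    (f m).1 = cf f m (f m).2 := by
  have : #((univ.filter fun x : Fin n => x.1 < m.1 ∧ (f x).2 = (f m).2).image fun x => (f x).1) =
      cf f m (f m).2 := by
    apply card_image_of_injOn
    intro x hx y hy hxy
    simp only [coe_filter, mem_univ, true_and, Set.mem_ofPred_eq] at hx hy
    exact hf.2.1 (Prod.ext hxy (hx.2.trans hy.2.symm))
  rw [← this]
  conv_lhs => rw [← card_range (f m).1]
  congr 1
  ext r
  simp only [mem_range, mem_image, mem_filter, mem_univ, true_and]
  constructor
  · intro hr
    have : (r, (f m).2) ∈ cells μ := by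
      rw [mem_cells']
      have := syt_lt hf m
      have := row_anti μ hr.le
      simp only; omega
    obtain ⟨x, hx⟩ := (hf.1 _).1 this
    refine ⟨x, ⟨?_, by rw [hx]⟩, by rw [hx]⟩
    exact Fin.lt_def.1 (hf.2.2.2 x m (by rw [hx]) (by rw [hx]; exact hr))
  · rintro ⟨x, ⟨h1, h2⟩, rfl⟩
    by_contra hc
    rcases (not_lt.1 hc).eq_or_lt with h | h
    · have := hf.2.1 (Prod.ext h h2.symm)
      rw [this] at h1; omega
    · have := Fin.lt_def.1 (hf.2.2.2 m x h2.symm h)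
      omega

theorem cf_inj {μ ν : Nat.Partition n} {f g : Fin n → ℕ × ℕ} (hf : IsSYT μ f) (hg : IsSYT ν g)
    (h : cf f = cf g) : f = g := by
  funext m
  have h2 : (f m).2 = (g m).2 := by
    have a := cf_succ f m (f m).2
    have b := cf_succ g m (f m).2
    rw [h] at a
    by_contra hc
    simp [hc] at a b
    omega
  apply Prod.ext _ h2
  rw [syt_fst hf, syt_fst hg, h, h2]

theorem SC.anti {C : ℕ → ℕ → ℕ} (hC : SC n C) (k : ℕ) (hk : k ≤ n) : Antitone (C k) := by
  apply antitone_nat_of_succ_le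
  intro c
  cases k with
  | zero => rw [hC.zero]; simp
  | succ k =>
    have := hC.il k hk c
    omega

theorem SC.supp {C : ℕ → ℕ → ℕ} (hC : SC n C) (k : ℕ) (hk : k ≤ n) (c : ℕ) (h : k ≤ c) :
    C k c = 0 := by
  induction k generalizing c with
  | zero => rw [hC.zero]; rfl
  | succ k ih =>
    obtain ⟨c, rfl⟩ : ∃ c', c = c'+1 := ⟨c-1, by omega⟩
    have := hC.il k hk c
    have := ih (by omega) c (by omega)
    omega

theorem SC.mono {C : ℕ → ℕ → ℕ} (hC : SC n C) (c : ℕ) : Monotone fun k => C k c := by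
  apply monotone_nat_of_le_succ
  intro k
  by_cases hk : k < n
  · exact (hC.il k hk c).1
  · rw [hC.stable k (by omega), hC.stable (k+1) (by omega)]

theorem SC.word {C : ℕ → ℕ → ℕ} (hC : SC n C) :
    ∃ w : Fin n → ℕ, ∀ (m : Fin n) (c : ℕ), C (m.1+1) c = C m.1 c + if c = w m then 1 else 0 := by
  have : ∀ m : Fin n, ∃ w, ∀ c, C (m.1+1) c = C m.1 c + if c = w then 1 else 0 := by
    intro m
    have il := hC.il m m.2
    have s : ∑ c ∈ range (n+1), (C (m.1+1) c - C m.1 c) = 1 := by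
      have a := hC.size m (by omega)
      have b := hC.size (m+1) (by omega)
      unfold sz at a b
      have : ∑ c ∈ range (n+1), (C (m.1+1) c - C m.1 c) + ∑ c ∈ range (n+1), C m.1 c =
          ∑ c ∈ range (n+1), C (m.1+1) c := by
        rw [← sum_add_distrib]
        exact sum_congr rfl fun c _ => by have := il c; omega
      omega
    obtain ⟨q, hq, h1, h2⟩ := sum_one s
    refine ⟨q, fun c => ?_⟩
    have := il c
    split_ifs with h
    · rw [h] at this ⊢; omega
    · by_cases hc : c < n+1
      · have := h2 c hc h; omega
      · rw [hC.supp _ (by omega) c (by omega), hC.supp _ (by omega) c (by omega)]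
  choose w hw using this
  exact ⟨w, hw⟩

theorem lower_card {s : Finset ℕ} (h : ∀ a ∈ s, ∀ b, b ≤ a → b ∈ s) (c : ℕ) : c < #s ↔ c ∈ s := by
  constructor
  · intro hc
    by_contra hn
    have : s ⊆ range c := by
      intro x hx
      rw [mem_range]
      by_contra hh
      exact hn (h x hx c (by omega))
    have := card_le_card this
    rw [card_range] at this
    omega
  · intro hc
    have : range (c+1) ⊆ s := by
      intro x hx
      rw [mem_range] at hx
      exact h c hc x (by omega)
    have := card_le_card this
    rw [card_range] at this
    omega

theorem SC.shape {C : ℕ → ℕ → ℕ} (hC : SC n C) :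
    ∃ μ : Nat.Partition n, ∀ r c, c < row μ r ↔ r < C n c := by
  have anti := hC.anti n le_rfl
  have supp := hC.supp n le_rfl
  let rl : ℕ → ℕ := fun r => #((range n).filter fun c => r < C n c)
  have hrl : ∀ r c, c < rl r ↔ r < C n c := by
    intro r c
    simp only [rl]
    rw [lower_card]
    · simp only [mem_filter, mem_range, and_iff_right_iff_imp]
      intro h
      by_contra hc
      rw [supp c (by omega)] at h
      omega
    · intro a ha b hb
      simp only [mem_filter, mem_range] at ha ⊢
      have := anti hb
      omega
  let l : List ℕ := (List.range (C n 0)).map rl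
  have hsum : l.sum = n := by
    have e : l.sum = ∑ r ∈ range (C n 0), rl r := by
      simp only [l]
      rw [Finset.sum_range, ← List.sum_ofFn]
      congr 1
      apply List.ext_getElem <;> simp
    rw [e]
    have h1 : ∑ r ∈ range (C n 0), rl r = ∑ c ∈ range n, C n c := by
      simp only [rl, card_filter]
      rw [sum_comm]
      apply sum_congr rfl
      intro c _
      rw [← card_filter]
      have : (range (C n 0)).filter (fun r => r < C n c) = range (C n c) := by
        ext r
        simp only [mem_filter, mem_range]
        have := anti (Nat.zero_le c)
        omega
      rw [this, card_range]
    have h2 := hC.size n le_rfl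
    unfold sz at h2
    rw [sum_range_succ, supp n le_rfl] at h2
    omega
  let μ : Nat.Partition n := ⟨(l : Multiset ℕ), by
    intro i hi
    simp only [Multiset.mem_coe, l, List.mem_map, List.mem_range] at hi
    obtain ⟨r, hr, rfl⟩ := hi
    exact (hrl r 0).2 hr, by simpa using hsum⟩
  have hsp : sortedParts μ = l := by
    unfold sortedParts
    change Multiset.sort (l : Multiset ℕ) (· ≥ ·) = l
    rw [Multiset.coe_sort]
    apply List.mergeSort_of_pairwise
    simp only [l]
    rw [List.pairwise_map]
    refine List.Pairwise.imp ?_ List.pairwise_lt_range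
    intro a b hab
    simp only [decide_eq_true_eq, ge_iff_le]
    apply card_le_card
    intro x hx
    simp only [mem_filter, mem_range] at hx ⊢
    omega
  refine ⟨μ, fun r c => ?_⟩
  unfold row
  rw [hsp, ← hrl]
  by_cases hr : r < C n 0
  · simp [l, hr]
  · rw [List.getD_eq_default _ _ (by simp [l]; omega)]
    have h1 := hrl r c
    have := anti (Nat.zero_le c)
    omega

theorem SC.exists_syt {C : ℕ → ℕ → ℕ} (hC : SC n C) {μ : Nat.Partition n}
    (hμ : ∀ r c, c < row μ r ↔ r < C n c) : ∃ f : Fin n → ℕ × ℕ, IsSYT μ f ∧ cf f = C := by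
  obtain ⟨w, hw⟩ := hC.word
  have hw1 : ∀ m : Fin n, C (m.1+1) (w m) = C m.1 (w m) + 1 := fun m => by rw [hw]; simp
  have mlt : ∀ (m m' : Fin n) c, C m.1 c < C m'.1 c → m < m' := by
    intro m m' c h
    by_contra hc
    have : C m'.1 c ≤ C m.1 c := hC.mono c (Fin.le_def.1 (not_lt.1 hc))
    omega
  have hcf : cf (fun m => (C m.1 (w m), w m)) = C := by
    have key : ∀ k, k ≤ n → ∀ c, cf (fun m => (C m.1 (w m), w m)) k c = C k c := by
      intro k
      induction k with
      | zero => intro _ c; rw [hC.zero]; simp [cf]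
      | succ k ih =>
        intro hk c
        rw [cf_succ _ ⟨k, hk⟩, hw ⟨k, hk⟩, ih (by omega)]
    funext k c
    rcases le_total k n with h | h
    · exact key k h c
    · rw [hC.stable k h, ← key n le_rfl]
      unfold cf
      congr 1
      ext m
      simp only [mem_filter, mem_univ, true_and]
      have := m.2
      constructor <;> rintro ⟨_, h⟩ <;> exact ⟨by omega, h⟩
  refine ⟨fun m => (C m.1 (w m), w m), ⟨?_, ?_, ?_, ?_⟩, hcf⟩
  · rintro ⟨r, c⟩
    rw [mem_cells', hμ]
    simp only [Prod.mk.injEq]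
    constructor
    · intro h
      have hex : ∃ k, r < C k c := ⟨n, h⟩
      classical
      have h1 := Nat.find_spec hex
      have h2 := fun k => Nat.find_min hex (m := k)
      have h3 : Nat.find hex ≤ n := Nat.find_min' hex h
      set k := Nat.find hex
      cases hk : k with
      | zero => rw [hk, hC.zero] at h1; simp at h1
      | succ k' =>
        have a := hw ⟨k', by omega⟩ c
        simp only at a
        have b := h2 k' (by omega)
        rw [hk] at h1
        refine ⟨⟨k', by omega⟩, ?_⟩
        split_ifs at a with hc
        · rw [← hc]
          refine ⟨?_, rfl⟩
          simp only; omega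
        · omega
    · rintro ⟨m, h1, rfl⟩
      have := hw1 m
      have : C (m.1+1) (w m) ≤ C n (w m) := hC.mono _ (show m.1+1 ≤ n by omega)
      omega
  · intro m m' h
    simp only [Prod.mk.injEq] at h
    obtain ⟨h1, h2⟩ := h
    rw [← h2] at h1
    rcases lt_trichotomy m m' with h | h | h
    · have := hw1 m
      have : C (m.1+1) (w m) ≤ C m' (w m) := hC.mono _ (Fin.lt_def.1 h)
      omega
    · exact h
    · have q := hw1 m'
      rw [← h2] at q
      have : C (m'.1+1) (w m) ≤ C m (w m) := hC.mono _ (Fin.lt_def.1 h)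
      omega
  · intro m m' h1 h2
    simp only at h1 h2
    apply mlt m m' (w m)
    have a := hw1 m'
    obtain ⟨c, hc⟩ : ∃ c, w m' = c + 1 := ⟨w m' - 1, by omega⟩
    have b := (hC.il m' m'.2 c).2
    rw [← hc] at b
    have d := hC.anti m' (by omega) (show w m ≤ c by omega)
    omega
  · intro m m' h1 h2
    simp only at h1 h2
    apply mlt m m' (w m)
    rw [← h1] at h2
    exact h2

abbrev SYT (μ : Nat.Partition n) : Type := {f : Fin n → ℕ × ℕ // IsSYT μ f}

def toTT (x : Σ μ : Nat.Partition n, SYT μ × SYT μ) : TT n :=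
  ⟨(cf x.2.1.1, cf x.2.2.1), cf_SC x.2.1.2, cf_SC x.2.2.2, by
    funext c
    exact (cf_n x.2.1.2 c).trans (cf_n x.2.2.2 c).symm⟩

theorem toTT_bij : Function.Bijective (toTT (n := n)) := by
  constructor
  · rintro ⟨μ, ⟨f, hf⟩, ⟨g, hg⟩⟩ ⟨ν, ⟨f', hf'⟩, ⟨g', hg'⟩⟩ h
    have h' := congrArg Subtype.val h
    have h1 : cf f = cf f' := congrArg Prod.fst h'
    have h2 : cf g = cf g' := congrArg Prod.snd h'
    obtain rfl := cf_inj hf hf' h1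
    obtain rfl := cf_inj hg hg' h2
    obtain rfl : μ = ν := by
      apply part_ext
      intro r c
      have a := mem_cells' μ (r, c)
      have b := mem_cells' ν (r, c)
      rw [hf.1] at a
      rw [hf'.1] at b
      exact a.symm.trans b
    rfl
  · rintro ⟨⟨C, D⟩, hC, hD, hCD⟩
    simp only at hC hD hCD
    obtain ⟨μ, hμ⟩ := hC.shape
    obtain ⟨f, hf, hfC⟩ := hC.exists_syt hμ
    obtain ⟨g, hg, hgD⟩ := hD.exists_syt (by rwa [hCD] at hμ)
    exact ⟨⟨μ, ⟨f, hf⟩, ⟨g, hg⟩⟩, Subtype.ext (Prod.ext hfC hgD)⟩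

theorem card_lis (P : ℕ → Prop) [DecidablePred P] :
    Nat.card {σ : Equiv.Perm (Fin n) // P (lis σ)} =
      ∑ μ ∈ Finset.univ.filter (fun μ : Nat.Partition n => P (Multiset.card μ.parts)),
        (sytCount μ) ^ 2 := by
  let e1 := Equiv.ofBijective _ (rsk_bij (n := n))
  let e2 := Equiv.ofBijective _ (toTT_bij (n := n))
  have h1 : ∀ σ, lis σ = (e1 σ).1.1 n 0 := by
    intro σ
    simp [e1, rsk, lis]
  have h2 : ∀ x, Multiset.card x.1.parts = (e2 x).1.1 n 0 := by
    intro x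
    exact (cf_n_zero x.2.1.2).symm
  let e := e1.trans e2.symm
  have h3 : ∀ σ, Multiset.card (e σ).1.parts = lis σ := by
    intro σ
    rw [h2, h1]
    simp [e]
  have hfin : Finite (Σ μ : Nat.Partition n, SYT μ × SYT μ) := Finite.of_equiv _ e
  have hf : ∀ μ : Nat.Partition n, Finite (SYT μ × SYT μ) := fun μ =>
    Finite.of_injective (Sigma.mk (β := fun μ : Nat.Partition n => SYT μ × SYT μ) μ)
      sigma_mk_injective
  have e' : {σ : Equiv.Perm (Fin n) // P (lis σ)} ≃
      {x : Σ μ : Nat.Partition n, SYT μ × SYT μ // P (Multiset.card x.1.parts)} :=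
    e.subtypeEquiv (fun σ => by rw [h3])
  rw [Nat.card_congr (e'.trans (Equiv.subtypeSigmaEquiv _
    (fun μ : Nat.Partition n => P (Multiset.card μ.parts)))), Nat.card_sigma]
  rw [← Finset.sum_subtype_eq_sum_filter, Finset.subtype_univ]
  apply sum_congr rfl
  intro μ _
  rw [Nat.card_prod, sq]
  rfl

theorem statement5 (n d : ℕ) (hd : 0 < d) (hdn : d < n) :
    Module.finrank ℂ (Jnd ℂ n d) =
      ∑ μ ∈ Finset.univ.filter (fun μ : Nat.Partition n => d < Multiset.card μ.parts),
        (sytCount μ) ^ 2 ∧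
    Module.finrank ℂ (MonoidAlgebra ℂ (Equiv.Perm (Fin n)) ⧸ Jnd ℂ n d) =
      ∑ μ ∈ Finset.univ.filter (fun μ : Nat.Partition n => Multiset.card μ.parts ≤ d),
        (sytCount μ) ^ 2 := by
  refine ⟨?_, ?_⟩
  · rw [finrank_J hdn, ← card_lis (fun x => d < x)]
    simp only [not_le]
  · rw [finrank_quot hdn, card_lis (fun x => x ≤ d)]
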